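/- Let s = 2^x for some integer x ≥ 0. Then the constant term c_0[E_{∞,4}^{−s}] of the Fourier expansion of E_{∞,4}^{−s} at infinity (an integer, equal to the coefficient of q^s in Π_{m>0 even}(1−q^m)^{−8s}·Π_{m>0 odd}(1−q^m)^{8s}) has 2-adic valuation exactly 3; indeed it is congruent to 8 modulo 16. -/

import Mathlib

open Complex Filter UpperHalfPlane
open scoped MatrixGroups ModularForm Manifold

noncomputable section

/-- `q = e^{2πiz}`. -/
def qexp (z : ℂ) : ℂ := Complex.exp (2 * Real.pi * Complex.I * z)

/-- `σ^odd(n) = Σ_{d∣n, d odd} d`. -/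
def sigmaOdd (n : ℕ) : ℕ := ∑ d ∈ n.divisors.filter (fun d => Odd d), d

/-- `σ₃^alt(n) = Σ_{d∣n} (-1)^d d³`. -/
def sigma3Alt (n : ℕ) : ℤ := ∑ d ∈ n.divisors, (-1 : ℤ) ^ d * (d : ℤ) ^ 3

/-- `σ*_{2,3}(n) = Σ_{d∣n, n/d odd} d³`. -/
def sigmaStar3 (n : ℕ) : ℕ := ∑ d ∈ n.divisors.filter (fun d => Odd (n / d)), d ^ 3

/-- `E_{γ,2} = 1 + 24 Σ σ^odd(n) qⁿ`. -/
def Egamma2 (z : ℂ) : ℂ := 1 + 24 * ∑' n : ℕ+, (sigmaOdd n : ℂ) * qexp z ^ (n : ℕ)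

/-- `E_{0,4} = 1 + 16 Σ σ₃^alt(n) qⁿ`. -/
def E04 (z : ℂ) : ℂ := 1 + 16 * ∑' n : ℕ+, (sigma3Alt n : ℂ) * qexp z ^ (n : ℕ)

/-- `E_{∞,4} = Σ σ*_{2,3}(n) qⁿ`. -/
def Einf4 (z : ℂ) : ℂ := ∑' n : ℕ+, (sigmaStar3 n : ℂ) * qexp z ^ (n : ℕ)

/-- `j₂ = E_{γ,2}² / E_{∞,4}`. -/
def j2 (z : ℂ) : ℂ := Egamma2 z ^ 2 / Einf4 z

open scoped Topology

/-- If `p` has integer coefficients and `p = 1 - X + O(X²)`, then the coefficient of `X ^ 2 ^ x`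
in `p ^ (8 * 2 ^ x)` is congruent to `8` modulo `16`. -/
lemma coeff_pow_eight_mul_two_pow (x : ℕ) (p : Polynomial ℤ) (h0 : p.coeff 0 = 1)
    (h1 : p.coeff 1 = -1) : (p ^ (8 * 2 ^ x)).coeff (2 ^ x) ≡ 8 [ZMOD 16] := by
  induction x with
  | zero =>
    have h : (p ^ 8).coeff 1 = (Polynomial.derivative (p ^ 8)).coeff 0 := by
      simp [Polynomial.coeff_derivative]
    have h' : (Polynomial.derivative p).coeff 0 = -1 := by
      simp [Polynomial.coeff_derivative, h1]
    have : (p ^ 8).coeff 1 = -8 := by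
      rw [h, Polynomial.derivative_pow, Polynomial.mul_coeff_zero, h', Polynomial.mul_coeff_zero,
        Polynomial.coeff_zero_eq_eval_zero (p ^ _), Polynomial.eval_pow,
        ← Polynomial.coeff_zero_eq_eval_zero, h0]
      simp
    norm_num [this, Int.ModEq]
  | succ x ih =>
    have h2 : ((2 : ℕ) : Polynomial ℤ) ∣ p ^ 2 - Polynomial.expand ℤ 2 p := by
      rw [show ((2 : ℕ) : Polynomial ℤ) = Polynomial.C 2 by simp, Polynomial.C_dvd_iff_dvd_coeff]
      intro i
      refine (ZMod.intCast_zmod_eq_zero_iff_dvd _ 2).1 ?_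
      have hz : (p ^ 2 - Polynomial.expand ℤ 2 p).map (Int.castRingHom (ZMod 2)) = 0 := by
        rw [Polynomial.map_sub, Polynomial.map_pow, Polynomial.map_expand, ZMod.expand_card,
          sub_self]
      simpa only [Polynomial.coeff_map, eq_intCast, Polynomial.coeff_zero] using
        congrArg (fun f => Polynomial.coeff f i) hz
    have h16 := (dvd_sub_pow_of_dvd_sub h2 3).trans (sub_dvd_pow_sub_pow _ _ (2 ^ x))
    have hp : ((p ^ 2) ^ 2 ^ 3) ^ 2 ^ x = p ^ (8 * 2 ^ (x + 1)) := by
      rw [← pow_mul, ← pow_mul]; congr 1; ring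
    have he : ((Polynomial.expand ℤ 2 p) ^ 2 ^ 3) ^ 2 ^ x
        = Polynomial.expand ℤ 2 (p ^ (8 * 2 ^ x)) := by
      rw [← pow_mul, map_pow]; norm_num
    rw [hp, he] at h16
    have hc : (16 : ℤ) ∣ (p ^ (8 * 2 ^ (x + 1)) -
        Polynomial.expand ℤ 2 (p ^ (8 * 2 ^ x))).coeff (2 ^ (x + 1)) := by
      obtain ⟨g, hg⟩ := h16
      rw [hg]
      have : ((2 : ℕ) : Polynomial ℤ) ^ (3 + 1) = Polynomial.C 16 := by
        norm_num
      rw [this, Polynomial.coeff_C_mul]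
      exact dvd_mul_right _ _
    rw [Polynomial.coeff_sub, pow_succ 2 x, Polynomial.coeff_expand_mul (by norm_num)] at hc
    rw [pow_succ 2 x]
    exact ((Int.modEq_iff_dvd.2 hc).symm).trans ih

/-- The coefficient of `X ^ s`, `s = 2 ^ x`, in the quotient `B ^ (8 * s) / A ^ (8 * s)`
computed modulo `X ^ (s + 1)`. -/
lemma coeff_quotient_modEq (x : ℕ) (A B R : Polynomial ℤ) (hA : Polynomial.X ^ 2 ∣ A - 1)
    (hB : Polynomial.X ^ 2 ∣ B - (1 - Polynomial.X))
    (h : Polynomial.X ^ (2 ^ x + 1) ∣ R * A ^ (8 * 2 ^ x) - B ^ (8 * 2 ^ x)) :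
    R.coeff (2 ^ x) ≡ 8 [ZMOD 16] := by
  have cast_dvd : ∀ {n : ℕ} {f g : Polynomial ℤ}, Polynomial.X ^ n ∣ f - g →
      (PowerSeries.X : PowerSeries ℤ) ^ n ∣ (f : PowerSeries ℤ) - g := by
    rintro n f g ⟨k, hk⟩
    refine ⟨k, ?_⟩
    rw [← Polynomial.coe_sub, hk]
    simp
  have hA' := cast_dvd hA
  have hB' := cast_dvd hB
  have h' := cast_dvd h
  simp only [Polynomial.coe_one, Polynomial.coe_sub, Polynomial.coe_X, Polynomial.coe_mul,
    Polynomial.coe_pow] at hA' hB' h'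
  have hu : IsUnit (A : PowerSeries ℤ) := by
    have := PowerSeries.X_pow_dvd_iff.1 hA' 0 (by norm_num)
    rw [PowerSeries.isUnit_iff_constantCoeff, ← PowerSeries.coeff_zero_eq_constantCoeff_apply]
    simp only [map_sub, sub_eq_zero] at this
    rw [this]
    simp
  obtain ⟨u, hu⟩ := hu.exists_right_inv
  set P : PowerSeries ℤ := B * u with hP
  have hP1 : (PowerSeries.X : PowerSeries ℤ) ^ 2 ∣ P - (1 - PowerSeries.X) := by
    have : P - (1 - PowerSeries.X) = u * (((B : PowerSeries ℤ) - (1 - PowerSeries.X))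
        - ((A : PowerSeries ℤ) - 1) * (1 - PowerSeries.X)) := by
      linear_combination (1 - PowerSeries.X) * hu
    rw [this]
    exact (dvd_sub hB' (hA'.mul_right _)).mul_left _
  have hR : (PowerSeries.X : PowerSeries ℤ) ^ (2 ^ x + 1) ∣ R - P ^ (8 * 2 ^ x) := by
    have h1 : (A : PowerSeries ℤ) ^ (8 * 2 ^ x) * u ^ (8 * 2 ^ x) = 1 := by
      rw [← mul_pow, hu, one_pow]
    have : (R : PowerSeries ℤ) - P ^ (8 * 2 ^ x) = u ^ (8 * 2 ^ x) *
        (R * (A : PowerSeries ℤ) ^ (8 * 2 ^ x) - (B : PowerSeries ℤ) ^ (8 * 2 ^ x)) := by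
      rw [hP, mul_pow]
      linear_combination -(R : PowerSeries ℤ) * h1
    rw [this]
    exact h'.mul_left _
  have hs : 1 < 2 ^ x + 1 := by have := Nat.one_le_two_pow (n := x); omega
  have key := coeff_pow_eight_mul_two_pow x (PowerSeries.trunc (2 ^ x + 1) P)
    (by
      rw [PowerSeries.coeff_trunc, if_pos (by omega)]
      have := PowerSeries.X_pow_dvd_iff.1 hP1 0 (by norm_num)
      simpa [sub_eq_zero] using this)
    (by
      rw [PowerSeries.coeff_trunc, if_pos hs]
      have := PowerSeries.X_pow_dvd_iff.1 hP1 1 (by norm_num)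
      simp [PowerSeries.coeff_one] at this
      linarith)
  have e1 := PowerSeries.X_pow_dvd_iff.1 hR (2 ^ x) (Nat.lt_succ_self _)
  have e2 := congrArg (fun f => Polynomial.coeff f (2 ^ x))
    (PowerSeries.trunc_trunc_pow P (2 ^ x + 1) (8 * 2 ^ x))
  simp only [PowerSeries.coeff_trunc, if_pos (Nat.lt_succ_self _)] at e2
  rw [map_sub, sub_eq_zero, Polynomial.coeff_coe, ← e2, ← Polynomial.coe_pow,
    Polynomial.coeff_coe] at e1
  rw [e1]
  exact key

/-- `p` approximates `f` along the positive reals to order `n` at `0`. -/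
def Approx (n : ℕ) (f : ℝ → ℂ) (p : Polynomial ℤ) : Prop :=
  (fun r : ℝ => f r - Polynomial.aeval (r : ℂ) p) =O[𝓝[>] 0] (fun r : ℝ => r ^ n)

lemma pow_isBigO_pow_of_le {m n : ℕ} (h : m ≤ n) :
    (fun r : ℝ => r ^ n) =O[𝓝[>] 0] (fun r : ℝ => r ^ m) := by
  refine Asymptotics.IsBigO.of_bound 1 ?_
  filter_upwards [Ioo_mem_nhdsGT (zero_lt_one' ℝ)] with r hr
  rw [one_mul, Real.norm_of_nonneg (pow_nonneg hr.1.le _),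
    Real.norm_of_nonneg (pow_nonneg hr.1.le _)]
  exact pow_le_pow_of_le_one hr.1.le hr.2.le h

lemma tendsto_aeval_nhdsGT_zero (p : Polynomial ℤ) :
    Tendsto (fun r : ℝ => Polynomial.aeval (r : ℂ) p) (𝓝[>] 0) (𝓝 (p.coeff 0 : ℂ)) := by
  have hc : Continuous (fun r : ℝ => Polynomial.aeval (r : ℂ) p) :=
    p.continuous_aeval.comp Complex.continuous_ofReal
  have := (hc.tendsto 0).mono_left (nhdsWithin_le_nhds (s := Set.Ioi 0))
  rwa [Complex.ofReal_zero, ← Polynomial.coeff_zero_eq_aeval_zero', eq_intCast] at this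

lemma aeval_isBigO_one (p : Polynomial ℤ) :
    (fun r : ℝ => Polynomial.aeval (r : ℂ) p) =O[𝓝[>] 0] (fun _ : ℝ => (1 : ℝ)) :=
  (tendsto_aeval_nhdsGT_zero p).isBigO_one ℝ

lemma Approx.mul {n : ℕ} {f g : ℝ → ℂ} {p q : Polynomial ℤ} (hf : Approx n f p)
    (hg : Approx n g q) : Approx n (fun r => f r * g r) (p * q) := by
  have h1 : (fun r : ℝ => f r - Polynomial.aeval (r : ℂ) p) =O[𝓝[>] 0] (fun _ : ℝ => (1 : ℝ)) := by
    simpa using hf.trans (pow_isBigO_pow_of_le (Nat.zero_le n))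
  have a := (h1.mul hg).add (((aeval_isBigO_one p).mul hg).add ((aeval_isBigO_one q).mul hf))
  simp only [one_mul] at a
  refine a.congr_left fun r => ?_
  rw [map_mul]; ring

lemma Approx.pow {n : ℕ} {f : ℝ → ℂ} {p : Polynomial ℤ} (hf : Approx n f p) (k : ℕ) :
    Approx n (fun r => f r ^ k) (p ^ k) := by
  induction k with
  | zero => simpa [Approx] using Asymptotics.isBigO_zero _ _
  | succ k ih => simpa only [pow_succ] using ih.mul hf

lemma X_pow_dvd_of_isBigO (n : ℕ) (p : Polynomial ℤ)
    (h : (fun r : ℝ => Polynomial.aeval (r : ℂ) p) =O[𝓝[>] 0] (fun r : ℝ => r ^ n)) :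
    Polynomial.X ^ n ∣ p := by
  induction n with
  | zero => simp
  | succ n ih =>
    obtain ⟨g, rfl⟩ := ih (h.trans (pow_isBigO_pow_of_le n.le_succ))
    rw [pow_succ]
    refine mul_dvd_mul_left _ (Polynomial.X_dvd_iff.2 ?_)
    have hg : (fun r : ℝ => Polynomial.aeval (r : ℂ) g) =O[𝓝[>] 0] (fun r : ℝ => r) := by
      obtain ⟨C, hC⟩ := h.bound
      refine Asymptotics.IsBigO.of_bound C ?_
      filter_upwards [hC, self_mem_nhdsWithin] with r hr (h0 : 0 < r)
      simp only [map_mul, map_pow, Polynomial.aeval_X, norm_mul, norm_pow, Complex.norm_real,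
        pow_succ] at hr
      have hp : 0 < ‖r‖ ^ n := pow_pos (norm_pos_iff.2 h0.ne') n
      refine le_of_mul_le_mul_left (hr.trans_eq ?_) hp
      ring
    have h0 : Tendsto (fun r : ℝ => r) (𝓝[>] 0) (𝓝 0) := nhdsWithin_le_nhds
    exact_mod_cast tendsto_nhds_unique (tendsto_aeval_nhdsGT_zero g) (hg.trans_tendsto h0)

lemma Approx.dvd_sub {n : ℕ} {f : ℝ → ℂ} {p q : Polynomial ℤ} (hp : Approx n f p)
    (hq : Approx n f q) : Polynomial.X ^ n ∣ p - q := by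
  refine X_pow_dvd_of_isBigO n _ ((hq.sub hp).congr_left fun r => ?_)
  rw [map_sub]; ring

lemma summable_pow_of_succ_le {r : ℝ} (h0 : 0 ≤ r) (h1 : r < 1) {e : ℕ → ℕ}
    (he : ∀ i, i + 1 ≤ e i) : Summable (fun i => ‖-(r : ℂ) ^ e i‖) := by
  refine Summable.of_nonneg_of_le (fun _ => norm_nonneg _) (fun i => ?_)
    (summable_geometric_of_lt_one h0 h1)
  rw [norm_neg, norm_pow, Complex.norm_real, Real.norm_of_nonneg h0]
  exact pow_le_pow_of_le_one h0 h1.le (by have := he i; omega)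

lemma multipliable_one_sub_pow_of_succ_le {r : ℝ} (h0 : 0 ≤ r) (h1 : r < 1) {e : ℕ → ℕ}
    (he : ∀ i, i + 1 ≤ e i) : Multipliable (fun i => 1 - (r : ℂ) ^ e i) := by
  simpa only [sub_eq_add_neg] using
    multipliable_one_add_of_summable (summable_pow_of_succ_le h0 h1 he)

lemma tprod_one_sub_pow_ne_zero {r : ℝ} (h0 : 0 ≤ r) (h1 : r < 1) {e : ℕ → ℕ}
    (he : ∀ i, i + 1 ≤ e i) : ∏' i, (1 - (r : ℂ) ^ e i) ≠ 0 := by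
  simp only [sub_eq_add_neg]
  refine tprod_one_add_ne_zero_of_summable (fun i h => ?_) (summable_pow_of_succ_le h0 h1 he)
  have : (r ^ e i : ℝ) < 1 := pow_lt_one₀ h0 h1 (by have := he i; omega)
  refine this.ne ?_
  have : (r : ℂ) ^ e i = 1 := by linear_combination -h
  exact_mod_cast this

lemma norm_tprod_one_sub_pow_sub_one_le {r : ℝ} (h0 : 0 ≤ r) (h1 : r ≤ 1 / 2) {e : ℕ → ℕ} (n : ℕ)
    (he : ∀ i, i + n + 1 ≤ e i) : ‖∏' i, (1 - (r : ℂ) ^ e i) - 1‖ ≤ 4 * r ^ n := by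
  have he' : ∀ i, i + 1 ≤ e i := fun i => by have := he i; omega
  have ht := (multipliable_one_sub_pow_of_succ_le h0 (by linarith) he').hasProd
  refine le_of_tendsto (ht.sub_const 1).norm (Eventually.of_forall fun s => ?_)
  simp only [sub_eq_add_neg (1 : ℂ)]
  refine (Finset.norm_prod_one_add_sub_one_le s _).trans ?_
  have hg : Summable (fun i : ℕ => r ^ (n + 1) * r ^ i) :=
    (summable_geometric_of_lt_one h0 (by linarith)).mul_left _
  have hpow : r ^ (n + 1) ≤ r ^ n * (1 / 2) := by
    rw [pow_succ]; exact mul_le_mul_of_nonneg_left h1 (pow_nonneg h0 n)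
  have hsum : ∑ i ∈ s, ‖-(r : ℂ) ^ e i‖ ≤ r ^ n := by
    calc ∑ i ∈ s, ‖-(r : ℂ) ^ e i‖ ≤ ∑ i ∈ s, r ^ (n + 1) * r ^ i := by
          refine Finset.sum_le_sum fun i _ => ?_
          rw [norm_neg, norm_pow, Complex.norm_real, Real.norm_of_nonneg h0, ← pow_add]
          exact pow_le_pow_of_le_one h0 (by linarith) (by have := he i; omega)
      _ ≤ ∑' i : ℕ, r ^ (n + 1) * r ^ i :=
          hg.sum_le_tsum s fun i _ => by positivity
      _ = r ^ (n + 1) * (1 - r)⁻¹ := by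
          rw [tsum_mul_left, tsum_geometric_of_lt_one h0 (by linarith)]
      _ ≤ (r ^ n * (1 / 2)) * 2 := by
          have : (1 - r)⁻¹ ≤ 2 := by
            rw [inv_le_comm₀ (by linarith) (by norm_num)]; linarith
          have : 0 ≤ (1 - r)⁻¹ := inv_nonneg.2 (by linarith)
          gcongr
      _ = r ^ n := by ring
  have hnn : 0 ≤ ∑ i ∈ s, ‖-(r : ℂ) ^ e i‖ := Finset.sum_nonneg fun _ _ => norm_nonneg _
  have hle : r ^ n ≤ 1 := pow_le_one₀ h0 (by linarith)
  have hb := Real.abs_exp_sub_one_le (abs_le.2 ⟨by linarith, hsum.trans hle⟩)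
  rw [abs_of_nonneg hnn] at hb
  linarith [le_abs_self (Real.exp (∑ i ∈ s, ‖-(r : ℂ) ^ e i‖) - 1)]

lemma approx_tprod {e : ℕ → ℕ} (he : ∀ i, i + 1 ≤ e i) (n : ℕ) :
    Approx n (fun r => ∏' i, (1 - (r : ℂ) ^ e i))
      (∏ i ∈ Finset.range n, (1 - Polynomial.X ^ e i)) := by
  have h4 : (fun r : ℝ => ∏' i, (1 - (r : ℂ) ^ e (i + n)) - 1) =O[𝓝[>] 0]
      (fun r : ℝ => r ^ n) := by
    refine Asymptotics.IsBigO.of_bound 4 ?_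
    filter_upwards [Ioo_mem_nhdsGT (show (0 : ℝ) < 1 / 2 by norm_num)] with r hr
    rw [Real.norm_of_nonneg (pow_nonneg hr.1.le n)]
    exact norm_tprod_one_sub_pow_sub_one_le hr.1.le hr.2.le n fun i => he (i + n)
  have h := (aeval_isBigO_one (∏ i ∈ Finset.range n, (1 - Polynomial.X ^ e i))).mul h4
  simp only [one_mul] at h
  refine h.congr' ?_ EventuallyEq.rfl
  filter_upwards [Ioo_mem_nhdsGT (zero_lt_one' ℝ)] with r hr
  have hm : Multipliable fun i => 1 - (r : ℂ) ^ e (i + n) :=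
    multipliable_one_sub_pow_of_succ_le hr.1.le hr.2 fun i => by have := he (i + n); omega
  rw [← Multipliable.prod_mul_tprod_nat_mul' (f := fun i => 1 - (r : ℂ) ^ e i) hm]
  simp only [map_prod, map_sub, map_one, map_pow, Polynomial.aeval_X]
  ring

lemma approx_tsum (R : ℕ → ℤ) {ρ : ℝ} (hρ : 0 < ρ)
    (hs : Summable fun n => (R n : ℂ) * (ρ : ℂ) ^ n) (n : ℕ) :
    Approx n (fun r => ∑' k, (R k : ℂ) * (r : ℂ) ^ k)
      (∑ k ∈ Finset.range n, Polynomial.C (R k) * Polynomial.X ^ k) := by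
  have hs' : Summable fun k => ‖(R (k + n) : ℂ) * (ρ : ℂ) ^ k‖ := by
    have := ((summable_nat_add_iff n).2 hs).mul_right ((ρ : ℂ) ^ n)⁻¹
    refine (this.congr fun k => ?_).norm
    have : (ρ : ℂ) ≠ 0 := by exact_mod_cast hρ.ne'
    field_simp
    ring
  refine Asymptotics.IsBigO.of_bound (∑' k, ‖(R (k + n) : ℂ) * (ρ : ℂ) ^ k‖) ?_
  filter_upwards [Ioo_mem_nhdsGT hρ] with r hr
  have hle : ∀ k, ‖(R (k + n) : ℂ) * (r : ℂ) ^ k‖ ≤ ‖(R (k + n) : ℂ) * (ρ : ℂ) ^ k‖ := fun k => by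
    rw [norm_mul, norm_mul, norm_pow, norm_pow, Complex.norm_real, Complex.norm_real,
      Real.norm_of_nonneg hr.1.le, Real.norm_of_nonneg hρ.le]
    have := pow_le_pow_left₀ hr.1.le hr.2.le k
    gcongr
  have hsr : Summable fun k => ‖(R (k + n) : ℂ) * (r : ℂ) ^ k‖ :=
    Summable.of_nonneg_of_le (fun _ => norm_nonneg _) hle hs'
  have heq : ∀ k, (R (k + n) : ℂ) * (r : ℂ) ^ (k + n)
      = (R (k + n) : ℂ) * (r : ℂ) ^ k * (r : ℂ) ^ n := fun k => by ring
  have hsr' : Summable fun k => (R k : ℂ) * (r : ℂ) ^ k :=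
    (summable_nat_add_iff n).1 ((hsr.of_norm.mul_right ((r : ℂ) ^ n)).congr fun k => (heq k).symm)
  have hsplit := hsr'.sum_add_tsum_nat_add n
  have : (∑' k, (R k : ℂ) * (r : ℂ) ^ k) - Polynomial.aeval (r : ℂ)
      (∑ k ∈ Finset.range n, Polynomial.C (R k) * Polynomial.X ^ k)
      = (∑' k, (R (k + n) : ℂ) * (r : ℂ) ^ k) * (r : ℂ) ^ n := by
    rw [← tsum_mul_right, ← tsum_congr heq, ← hsplit]
    simp
  rw [this, norm_mul, norm_pow, Complex.norm_real, norm_pow]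
  gcongr
  exact (norm_tsum_le_tsum_norm hsr).trans (hsr.tsum_le_tsum hle hs')

lemma X_sq_dvd_prod_sub_one {e : ℕ → ℕ} (he : ∀ i, 2 ≤ e i) (s : Finset ℕ) :
    (Polynomial.X : Polynomial ℤ) ^ 2 ∣ ∏ i ∈ s, (1 - Polynomial.X ^ e i) - 1 := by
  induction s using Finset.induction_on with
  | empty => simp
  | insert a s ha ih =>
    rw [Finset.prod_insert ha]
    have := dvd_sub ih ((pow_dvd_pow (Polynomial.X : Polynomial ℤ) (he a)).mul_right
      (∏ i ∈ s, (1 - Polynomial.X ^ e i)))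
    convert this using 1
    ring

lemma exists_upperHalfPlane_qexp_eq {r : ℝ} (h0 : 0 < r) (h1 : r < 1) :
    ∃ z : ℍ, qexp (z : ℂ) = r := by
  have hpi := Real.pi_pos
  have hlog := Real.log_neg h0 h1
  refine ⟨⟨Complex.I * ((-Real.log r / (2 * Real.pi) : ℝ) : ℂ), ?_⟩, ?_⟩
  · simp only [Complex.mul_im, Complex.I_re, Complex.I_im, Complex.ofReal_re, Complex.ofReal_im]
    have : 0 < -Real.log r / (2 * Real.pi) := div_pos (by linarith) (by linarith)
    linarith
  · have : 2 * (Real.pi : ℂ) * Complex.I *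
        (Complex.I * ((-Real.log r / (2 * Real.pi) : ℝ) : ℂ)) = (Real.log r : ℝ) := by
      have : (Real.pi : ℂ) ≠ 0 := by exact_mod_cast hpi.ne'
      push_cast
      field_simp
      rw [Complex.I_sq]
      ring
    change Complex.exp (2 * (Real.pi : ℂ) * Complex.I *
        (Complex.I * ((-Real.log r / (2 * Real.pi) : ℝ) : ℂ))) = r
    rw [this, ← Complex.ofReal_exp, Real.exp_log h0]

/-- Theorem 4.1: for `s = 2^x`, the constant term `c₀[E_{∞,4}^{−s}]` (the coefficient of
`qˢ` in `Π_{m even}(1−qᵐ)^{−8s} · Π_{m odd}(1−qᵐ)^{8s}`) has 2-adic valuation exactly 3;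
indeed it is congruent to 8 modulo 16. -/
theorem stmt16 (x : ℕ) (R : ℕ → ℤ)
    (hexp : ∀ z : ℍ,
      (∏' m : ℕ+, ((1 - qexp (z : ℂ) ^ (2 * (m : ℕ))) ^ (8 * 2 ^ x))⁻¹) *
          (∏' m : ℕ+, (1 - qexp (z : ℂ) ^ (2 * (m : ℕ) - 1)) ^ (8 * 2 ^ x)) =
        ∑' n : ℕ, (R n : ℂ) * qexp (z : ℂ) ^ n) :
    padicValInt 2 (R (2 ^ x)) = 3 ∧ R (2 ^ x) ≡ 8 [ZMOD 16] := by
  have heA : ∀ i, i + 1 ≤ 2 * (i + 1) := fun i => by omega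
  have heB : ∀ i, i + 1 ≤ 2 * (i + 1) - 1 := fun i => by omega
  have hmain : ∀ r : ℝ, 0 < r → r < 1 →
      ((∏' i : ℕ, (1 - (r : ℂ) ^ (2 * (i + 1)))) ^ (8 * 2 ^ x))⁻¹ *
        (∏' i : ℕ, (1 - (r : ℂ) ^ (2 * (i + 1) - 1))) ^ (8 * 2 ^ x)
        = ∑' n : ℕ, (R n : ℂ) * (r : ℂ) ^ n := by
    intro r h0 h1
    obtain ⟨z, hz⟩ := exists_upperHalfPlane_qexp_eq h0 h1
    have hA := multipliable_one_sub_pow_of_succ_le h0.le h1 heA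
    have hB := multipliable_one_sub_pow_of_succ_le h0.le h1 heB
    have h := hexp z
    rw [hz, tprod_pnat_eq_tprod_succ (f := fun m => ((1 - (r : ℂ) ^ (2 * m)) ^ (8 * 2 ^ x))⁻¹),
      tprod_pnat_eq_tprod_succ (f := fun m => (1 - (r : ℂ) ^ (2 * m - 1)) ^ (8 * 2 ^ x)),
      hB.tprod_pow] at h
    rw [← h, ← hA.tprod_pow]
    congr 1
    refine ((hA.pow _).hasProd.inv₀ ?_).tprod_eq.symm
    rw [hA.tprod_pow]
    exact pow_ne_zero _ (tprod_one_sub_pow_ne_zero h0.le h1 heA)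
  have hsum : Summable fun n => (R n : ℂ) * ((1 / 2 : ℝ) : ℂ) ^ n := by
    by_contra hns
    have h := hmain (1 / 2) (by norm_num) (by norm_num)
    rw [tsum_eq_zero_of_not_summable hns] at h
    exact mul_ne_zero
      (inv_ne_zero (pow_ne_zero _ (tprod_one_sub_pow_ne_zero (by norm_num) (by norm_num) heA)))
      (pow_ne_zero _ (tprod_one_sub_pow_ne_zero (by norm_num) (by norm_num) heB)) h
  have hL := (approx_tsum R (by norm_num) hsum (2 ^ x + 1)).mul
    ((approx_tprod heA (2 ^ x + 1)).pow (8 * 2 ^ x))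
  have hBapp := (approx_tprod heB (2 ^ x + 1)).pow (8 * 2 ^ x)
  have hL' := Asymptotics.IsBigO.congr' hL (f₂ := fun r : ℝ =>
    (∏' i : ℕ, (1 - (r : ℂ) ^ (2 * (i + 1) - 1))) ^ (8 * 2 ^ x) - Polynomial.aeval (r : ℂ) _)
    (by
      filter_upwards [Ioo_mem_nhdsGT (zero_lt_one' ℝ)] with r hr
      rw [← hmain r hr.1 hr.2]
      have := pow_ne_zero (8 * 2 ^ x) (tprod_one_sub_pow_ne_zero hr.1.le hr.2 heA)
      congr 1
      field_simp) EventuallyEq.rfl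
  have hdvd := Approx.dvd_sub hL' hBapp
  have h16 : R (2 ^ x) ≡ 8 [ZMOD 16] := by
    have h := coeff_quotient_modEq x _ _ _
      (X_sq_dvd_prod_sub_one (fun i => by omega) _) ?_ hdvd
    · simpa [Polynomial.finsetSum_coeff, Polynomial.coeff_X_pow] using h
    · rw [Finset.prod_range_succ']
      have := (X_sq_dvd_prod_sub_one (e := fun i => 2 * (i + 1 + 1) - 1) (fun i => by omega)
        (Finset.range (2 ^ x))).mul_right (1 - Polynomial.X)
      convert this using 1
      simp
      ring
  refine ⟨?_, h16⟩
  obtain ⟨k, hk⟩ := (Int.modEq_iff_dvd.1 h16)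
  have hR : R (2 ^ x) = 2 ^ 3 * (1 - 2 * k) := by linarith
  have hne : (1 - 2 * k : ℤ) ≠ 0 := by omega
  rw [hR, padicValInt.mul (by norm_num) hne,
    padicValInt.eq_zero_of_not_dvd (z := 1 - 2 * k) (by push_cast; omega)]
  have := padicValInt.of_nat (p := 2) (n := 2 ^ 3)
  rw [padicValNat.prime_pow] at this
  exact_mod_cast this
end
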